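/- Let (X, d, μ) be a metric measure space whose measure is Ahlfors ν-regular with constants 0 < c₁ ≤ c₂ < ∞ satisfying 2^{1−ν}·(c₂/c₁) < 1, and let K be a kernel satisfying the size condition and the pseudo-radial null condition. Let f : X → ℝ be locally integrable and let g : X → [0,∞] be locally integrable such that the pair (f, g) satisfies a weak (1, ρ')-Poincaré–Sobolev inequality for some 1 < ρ' < ν. Suppose g belongs to the Morrey space M^{p,q}_μ(X) for some 1 < p ≤ q < ∞ with q/ν < 1, and let 1 < p₁ ≤ q₁ < ∞ be exponents with (1 − q/ν)·p₁ > 1 such that g belongs to the Morrey space M^{(1−q/ν)p₁,(1−q/ν)q₁}_μ(X). Then there is a constant C such that ‖T*_K f‖_{M^{p₁,q₁}} ≤ C · ‖g‖_{M^{(1−q/ν)p₁,(1−q/ν)q₁}}^{1 − q/ν} · ‖g‖_{M^{p,q}}^{q/ν}. -/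

import Mathlib

open MeasureTheory Metric ENNReal

variable {X : Type*} [MetricSpace X] [MeasurableSpace X] [BorelSpace X]

/-- Riesz-type potential `R_{s,μ} g (x) = ∫ d(x,y)^s / μ(B(x,d(x,y))) · g(y) dμ(y)`,
for `g : X → [0,∞]`, valued in `[0,∞]`. -/
noncomputable def rieszPot (μ : Measure X) (s : ℝ) (g : X → ℝ≥0∞) (x : X) : ℝ≥0∞ :=
  ∫⁻ y, (ENNReal.ofReal (dist x y ^ s) / μ (ball x (dist x y))) * g y ∂μ

/-- Riesz-type potential applied to a real (signed) function, as a Bochner integral. -/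
noncomputable def rieszR (μ : Measure X) (s : ℝ) (f : X → ℝ) (x : X) : ℝ :=
  ∫ y, (dist x y ^ s / (μ (ball x (dist x y))).toReal) * f y ∂μ

/-- Hardy–Littlewood maximal function: sup over open balls containing `x`. -/
noncomputable def maximalFn (μ : Measure X) (g : X → ℝ≥0∞) (x : X) : ℝ≥0∞ :=
  ⨆ (z : X) (r : ℝ) (_ : 0 < r) (_ : x ∈ ball z r),
    (μ (ball z r))⁻¹ * ∫⁻ y in ball z r, g y ∂μ

/-- Morrey norm `‖g‖_{M^{p,q}}`, valued in `[0,∞]`. -/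
noncomputable def morreyNorm (μ : Measure X) (p q : ℝ) (g : X → ℝ≥0∞) : ℝ≥0∞ :=
  ⨆ (z : X) (r : ℝ) (_ : 0 < r),
    (μ (ball z r) ^ (p / q - 1) * ∫⁻ y in ball z r, g y ^ p ∂μ) ^ (1 / p)

/-- Truncated singular integral `T^ε_K f (x)`. -/
noncomputable def truncT (μ : Measure X) (K : X → X → ℝ) (f : X → ℝ) (ε : ℝ) (x : X) : ℝ :=
  ∫ y in {y | ε < dist x y}, K x y * f y ∂μ

/-- Maximal singular operator `T^*_K f (x) = sup_{ε>0} |T^ε_K f (x)|`, valued in `[0,∞]`. -/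
noncomputable def maxT (μ : Measure X) (K : X → X → ℝ) (f : X → ℝ) (x : X) : ℝ≥0∞ :=
  ⨆ (ε : ℝ) (_ : 0 < ε), ENNReal.ofReal |truncT μ K f ε x|

/-- Ahlfors `ν`-regularity: `c₁ r^ν ≤ μ(B(x,r)) ≤ c₂ r^ν`. -/
def IsAhlfors (μ : Measure X) (c₁ c₂ ν : ℝ) : Prop :=
  ∀ (x : X) (r : ℝ), 0 < r →
    ENNReal.ofReal (c₁ * r ^ ν) ≤ μ (ball x r) ∧ μ (ball x r) ≤ ENNReal.ofReal (c₂ * r ^ ν)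

/-- Size condition on the kernel: `|K(x,y)| ≤ C_K / d(x,y)^ν` for `x ≠ y`. -/
def SizeCond (K : X → X → ℝ) (CK ν : ℝ) : Prop :=
  ∀ x y : X, x ≠ y → |K x y| ≤ CK / dist x y ^ ν

/-- Pseudo-radial null condition: `∫_{a < d(x,y) < b} K(x,y) dμ(y) = 0`. -/
def NullCond (μ : Measure X) (K : X → X → ℝ) : Prop :=
  ∀ (x : X) (a b : ℝ), 0 < a → a < b →
    ∫ y in {y | a < dist x y ∧ dist x y < b}, K x y ∂μ = 0

/-- Weak `(1,ρ')`-Poincaré–Sobolev inequality for the pair `(f,g)` with constants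
`C_P > 0` and dilation `σ`. -/
def PoincareSobolev (μ : Measure X) (f : X → ℝ) (g : X → ℝ≥0∞) (ρ' CP σ : ℝ) : Prop :=
  ∀ (x : X) (r : ℝ), 0 < r →
    ((μ (ball x r))⁻¹ *
        ∫⁻ y in ball x r, ENNReal.ofReal (|f y - ⨍ z in ball x r, f z ∂μ| ^ ρ') ∂μ) ^ (1 / ρ')
      ≤ ENNReal.ofReal (CP * r) *
        ((μ (ball x (σ * r)))⁻¹ * ∫⁻ y in ball x (σ * r), g y ∂μ)

/-- Local integrability for an `[0,∞]`-valued function: measurable with finite integral on balls. -/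
def LocIntE (μ : Measure X) (g : X → ℝ≥0∞) : Prop :=
  Measurable g ∧ ∀ (z : X) (r : ℝ), ∫⁻ y in ball z r, g y ∂μ < ∞

/-- `L^r` norm (in `[0,∞]`) of an `[0,∞]`-valued function. -/
noncomputable def lpNormE (μ : Measure X) (r : ℝ) (h : X → ℝ≥0∞) : ℝ≥0∞ :=
  (∫⁻ x, h x ^ r ∂μ) ^ (1 / r)

/-- Lorentz `L^{r,m}` quasinorm (in `[0,∞]`) of an `[0,∞]`-valued function. -/
noncomputable def lorentzNormE (μ : Measure X) (r m : ℝ) (h : X → ℝ≥0∞) : ℝ≥0∞ :=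
  ENNReal.ofReal (r ^ (1 / m)) *
    (∫⁻ α in Set.Ioi (0 : ℝ),
        (ENNReal.ofReal α * μ {x | ENNReal.ofReal α < h x} ^ (1 / r)) ^ m *
          ENNReal.ofReal α⁻¹) ^ (1 / m)

set_option linter.unusedSectionVars false

namespace IsAhlfors

variable {μ : Measure X} {c₁ c₂ ν : ℝ}

theorem measure_ball_lt_top (hA : IsAhlfors μ c₁ c₂ ν) (x : X) (r : ℝ) : μ (ball x r) < ∞ := by
  rcases le_or_gt r 0 with hr | hr
  · simp [ball_eq_empty.2 hr]
  · exact (hA x r hr).2.trans_lt ofReal_lt_top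

theorem measure_ball_pos (hA : IsAhlfors μ c₁ c₂ ν) (hc₁ : 0 < c₁) (x : X) {r : ℝ} (hr : 0 < r) :
    0 < μ (ball x r) :=
  (ofReal_pos.2 (by positivity)).trans_le (hA x r hr).1

theorem sigmaFinite (hA : IsAhlfors μ c₁ c₂ ν) : SigmaFinite μ := by
  rcases isEmpty_or_nonempty X with h | ⟨⟨x₀⟩⟩
  · rw [Measure.eq_zero_of_isEmpty μ]
    infer_instance
  · exact ⟨⟨⟨fun n : ℕ => ball x₀ n, fun _ => trivial, fun n => hA.measure_ball_lt_top x₀ n,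
      iUnion_ball_nat x₀⟩⟩⟩

/-- The measures of two balls are comparable when the ratio of their radii is controlled. -/
theorem measure_ball_le_mul (hA : IsAhlfors μ c₁ c₂ ν) (hc₁ : 0 < c₁) (hc₂ : 0 < c₂)
    {a : ℝ} (ha : 0 < a) (x y : X) {r s : ℝ} (hs : 0 < s) (hrs : r ≤ a * s) :
    μ (ball x r) ≤ ENNReal.ofReal (c₂ / c₁ * a ^ ν) * μ (ball y s) := by
  calc μ (ball x r) ≤ μ (ball x (a * s)) := measure_mono (ball_subset_ball hrs)
    _ ≤ ENNReal.ofReal (c₂ * (a * s) ^ ν) := (hA x (a * s) (by positivity)).2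
    _ = ENNReal.ofReal (c₂ / c₁ * a ^ ν) * ENNReal.ofReal (c₁ * s ^ ν) := by
        rw [← ENNReal.ofReal_mul (by positivity), Real.mul_rpow ha.le hs.le]
        congr 1
        field_simp
    _ ≤ _ := by gcongr; exact (hA y s hs).1

/-- The radii of balls of bounded measure are bounded. -/
theorem exists_radius_le (hA : IsAhlfors μ c₁ c₂ ν) (hc₁ : 0 < c₁) (hν : 0 < ν) {m : ℝ≥0∞}
    (hm : m ≠ ∞) : ∃ R : ℝ, ∀ (x : X) (r : ℝ), μ (ball x r) ≤ m → r ≤ R := by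
  refine ⟨(m.toReal / c₁) ^ (1 / ν), fun x r h => ?_⟩
  rcases le_or_gt r 0 with hr | hr
  · exact hr.trans (by positivity)
  have h1 : c₁ * r ^ ν ≤ m.toReal :=
    (ofReal_le_iff_le_toReal hm).1 ((hA x r hr).1.trans h)
  have h2 : r ^ ν ≤ m.toReal / c₁ := by rw [le_div_iff₀ hc₁]; linarith
  calc r = (r ^ ν) ^ (1 / ν) := by
        rw [← Real.rpow_mul hr.le, mul_one_div_cancel hν.ne', Real.rpow_one]
    _ ≤ _ := by gcongr

end IsAhlfors

/-- Hölder's inequality against the constant function `1`; no measurability is needed, since the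
lower integral is attained by measurable minorants. -/
theorem lintegral_le_lintegral_rpow_mul_measure_univ {α : Type*} [MeasurableSpace α]
    (m : Measure α) (h : α → ℝ≥0∞) {s : ℝ} (hs : 1 < s) :
    ∫⁻ x, h x ∂m ≤ (∫⁻ x, h x ^ s ∂m) ^ (1 / s) * m Set.univ ^ (1 - 1 / s) := by
  obtain ⟨k, hk, hkh, hint⟩ := exists_measurable_le_lintegral_eq m h
  have hconj := Real.HolderConjugate.conjExponent hs
  have hexp : 1 / s.conjExponent = 1 - 1 / s := by
    have := hconj.inv_add_inv_eq_one
    simp only [one_div]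
    linarith
  have key := ENNReal.lintegral_mul_le_Lp_mul_Lq m hconj hk.aemeasurable
    (measurable_const (a := (1 : ℝ≥0∞))).aemeasurable
  simp only [Pi.mul_apply, mul_one, one_rpow, lintegral_const, one_mul, hexp] at key
  rw [hint]
  refine key.trans ?_
  gcongr
  exact hkh _

/-- Averages over balls are controlled by the `L^s`-averages. -/
theorem laverage_le_rpow {μ : Measure X} {B : Set X} (hB0 : μ B ≠ 0) (hB : μ B ≠ ∞)
    (h : X → ℝ≥0∞) {s : ℝ} (hs : 1 < s) :
    (μ B)⁻¹ * ∫⁻ y in B, h y ∂μ ≤ ((μ B)⁻¹ * ∫⁻ y in B, h y ^ s ∂μ) ^ (1 / s) := by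
  have hs0 : 0 < s := by linarith
  have key := lintegral_le_lintegral_rpow_mul_measure_univ (μ.restrict B) h hs
  rw [Measure.restrict_apply_univ] at key
  rw [mul_rpow_of_nonneg _ _ (by positivity), ENNReal.inv_rpow, ← ENNReal.rpow_neg]
  calc _ ≤ (μ B)⁻¹ * ((∫⁻ y in B, h y ^ s ∂μ) ^ (1 / s) * μ B ^ (1 - 1 / s)) := by gcongr
    _ = (μ B ^ (-1 : ℝ) * μ B ^ (1 - 1 / s)) * (∫⁻ y in B, h y ^ s ∂μ) ^ (1 / s) := by
        rw [ENNReal.rpow_neg_one]; ring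
    _ = _ := by
        rw [← ENNReal.rpow_add _ _ hB0 hB]
        congr 2
        ring

/-- The average of a function over a ball, estimated by its Morrey norm. -/
theorem laverage_le_morreyNorm {μ : Measure X} (g : X → ℝ≥0∞) {s t : ℝ} (hs : 1 < s) (z : X)
    {r : ℝ} (hr : 0 < r) (h0 : μ (ball z r) ≠ 0) (htop : μ (ball z r) ≠ ∞) :
    (μ (ball z r))⁻¹ * ∫⁻ y in ball z r, g y ∂μ ≤
      μ (ball z r) ^ (-(1 / t)) * morreyNorm μ s t g := by
  have hs0 : 0 < s := by linarith
  have hle : (μ (ball z r) ^ (s / t - 1) * ∫⁻ y in ball z r, g y ^ s ∂μ) ^ (1 / s) ≤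
      morreyNorm μ s t g :=
    le_iSup₂_of_le z r (le_iSup_of_le hr le_rfl)
  refine (laverage_le_rpow h0 htop g hs).trans ?_
  refine le_trans (le_of_eq ?_) (mul_le_mul_right hle _)
  rw [mul_rpow_of_nonneg _ _ (by positivity), mul_rpow_of_nonneg _ _ (by positivity), ← mul_assoc,
    ← ENNReal.rpow_mul, ← ENNReal.rpow_add _ _ h0 htop, ← ENNReal.rpow_neg_one, ← ENNReal.rpow_mul]
  congr 2
  field_simp
  ring

theorem laverage_le_maximalFn (μ : Measure X) (g : X → ℝ≥0∞) (x : X) {z : X} {r : ℝ}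
    (hr : 0 < r) (hx : x ∈ ball z r) :
    (μ (ball z r))⁻¹ * ∫⁻ y in ball z r, g y ∂μ ≤ maximalFn μ g x :=
  le_iSup₂_of_le z r (le_iSup₂_of_le hr hx le_rfl)

theorem lt_maximalFn_iff {μ : Measure X} {g : X → ℝ≥0∞} {x : X} {t : ℝ≥0∞} :
    t < maximalFn μ g x ↔ ∃ (z : X) (r : ℝ), 0 < r ∧ x ∈ ball z r ∧
      t < (μ (ball z r))⁻¹ * ∫⁻ y in ball z r, g y ∂μ := by
  simp only [maximalFn, lt_iSup_iff, exists_prop]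

theorem measurable_maximalFn (μ : Measure X) (g : X → ℝ≥0∞) : Measurable (maximalFn μ g) := by
  refine measurable_of_Ioi fun t => IsOpen.measurableSet ?_
  have : maximalFn μ g ⁻¹' Set.Ioi t = ⋃ (z : X) (r : ℝ) (_ : 0 < r)
      (_ : t < (μ (ball z r))⁻¹ * ∫⁻ y in ball z r, g y ∂μ), ball z r := by
    ext x
    simp only [Set.mem_preimage, Set.mem_Ioi, lt_maximalFn_iff, Set.mem_iUnion, exists_prop]
    tauto
  rw [this]
  exact isOpen_iUnion fun _ => isOpen_iUnion fun _ => isOpen_iUnion fun _ => isOpen_iUnion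
    fun _ => isOpen_ball

/-- Weak type `(1,1)` estimate for the maximal function. -/
theorem mul_measure_lt_maximalFn_le {μ : Measure X} {c₁ c₂ ν : ℝ} (hA : IsAhlfors μ c₁ c₂ ν)
    (hc₁ : 0 < c₁) (hc₂ : 0 < c₂) (hν : 0 < ν) (g : X → ℝ≥0∞) {t : ℝ≥0∞} (ht0 : t ≠ 0)
    (ht : t ≠ ∞) :
    t * μ {x | t < maximalFn μ g x} ≤ ENNReal.ofReal (c₂ / c₁ * 6 ^ ν) * ∫⁻ y, g y ∂μ := by
  have := hA.sigmaFinite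
  set D := ENNReal.ofReal (c₂ / c₁ * 6 ^ ν)
  have hD0 : D ≠ 0 := (ofReal_pos.2 (by positivity)).ne'
  rcases eq_or_ne (∫⁻ y, g y ∂μ) ∞ with hg | hg
  · rw [hg, mul_top hD0]; exact le_top
  let S : Set (X × ℝ) := {a | 0 < a.2 ∧ t < (μ (ball a.1 a.2))⁻¹ * ∫⁻ y in ball a.1 a.2, g y ∂μ}
  have hS : ∀ a ∈ S, t * μ (ball a.1 a.2) ≤ ∫⁻ y in ball a.1 a.2, g y ∂μ := by
    rintro ⟨z, r⟩ ⟨hr, h⟩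
    refine ENNReal.mul_le_of_le_div ?_
    rw [div_eq_mul_inv, mul_comm]
    exact h.le
  obtain ⟨R, hR⟩ := hA.exists_radius_le hc₁ hν (m := t⁻¹ * ∫⁻ y, g y ∂μ)
    (mul_ne_top (inv_ne_top.2 ht0) hg)
  obtain ⟨u, huS, hdisj, hcov⟩ := Vitali.exists_disjoint_subfamily_covering_enlargement_closedBall
    S Prod.fst Prod.snd R (fun a ha => hR a.1 a.2 (by
      rw [mul_comm, ← div_eq_mul_inv, ENNReal.le_div_iff_mul_le (Or.inl ht0) (Or.inl ht), mul_comm]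
      exact (hS a ha).trans (setLIntegral_le_lintegral _ _))) 5 (by norm_num)
  have hdisj' : u.PairwiseDisjoint fun a => ball a.1 a.2 :=
    hdisj.mono fun a => ball_subset_closedBall
  have hcount : u.Countable := by
    have h := Measure.countable_meas_pos_of_disjoint_iUnion (μ := μ)
      (As := fun a : u => ball a.1.1 a.1.2) (fun _ => measurableSet_ball)
      (fun a b hab => hdisj' a.2 b.2 (fun h => hab (Subtype.ext h)))
    have : {a : u | 0 < μ (ball a.1.1 a.1.2)} = Set.univ :=
      Set.eq_univ_of_forall fun a => hA.measure_ball_pos hc₁ _ (huS a.2).1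
    rw [this] at h
    exact Set.countable_coe_iff.1 (Set.countable_univ_iff.1 h)
  have hsub : {x | t < maximalFn μ g x} ⊆ ⋃ a ∈ u, ball a.1 (6 * a.2) := by
    intro x hx
    obtain ⟨z, r, hr, hxz, h⟩ := lt_maximalFn_iff.1 hx
    obtain ⟨b, hb, hbz⟩ := hcov (z, r) ⟨hr, h⟩
    refine Set.mem_biUnion hb (closedBall_subset_ball ?_ (hbz (ball_subset_closedBall hxz)))
    have := (huS hb).1
    linarith
  calc t * μ {x | t < maximalFn μ g x} ≤ t * ∑' a : u, μ (ball a.1.1 (6 * a.1.2)) := by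
        gcongr
        exact (measure_mono hsub).trans (measure_biUnion_le μ hcount _)
    _ ≤ t * ∑' a : u, D * μ (ball a.1.1 a.1.2) := by
        gcongr with a
        exact hA.measure_ball_le_mul hc₁ hc₂ (by norm_num) _ _ (huS a.2).1 le_rfl
    _ = D * ∑' a : u, t * μ (ball a.1.1 a.1.2) := by
        rw [ENNReal.tsum_mul_left, ENNReal.tsum_mul_left]; ring
    _ ≤ D * ∑' a : u, ∫⁻ y in ball a.1.1 a.1.2, g y ∂μ := by
        gcongr with a
        exact hS a (huS a.2)
    _ = D * ∫⁻ y in ⋃ a ∈ u, ball a.1 a.2, g y ∂μ := by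
        rw [lintegral_biUnion hcount (fun _ _ => measurableSet_ball) hdisj']
    _ ≤ D * ∫⁻ y, g y ∂μ := mul_le_mul_right (setLIntegral_le_lintegral _ _) _

theorem lintegral_Ioi_indicator_rpow {a : ℝ} (ha : 0 < a) (y : ℝ≥0∞) :
    ∫⁻ t in Set.Ioi (0 : ℝ),
      {t : ℝ | ENNReal.ofReal t < y}.indicator (fun t => ENNReal.ofReal (t ^ (a - 1))) t =
      ENNReal.ofReal (1 / a) * y ^ a := by
  have hfin : ∀ b : ℝ, 0 ≤ b → ∫⁻ t in Set.Ioi (0 : ℝ),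
      {t : ℝ | ENNReal.ofReal t < ENNReal.ofReal b}.indicator
        (fun t => ENNReal.ofReal (t ^ (a - 1))) t =
      ENNReal.ofReal (1 / a) * ENNReal.ofReal b ^ a := by
    intro b hb
    rw [lintegral_indicator (measurableSet_lt measurable_ofReal measurable_const),
      Measure.restrict_restrict (measurableSet_lt measurable_ofReal measurable_const)]
    have hset : {t : ℝ | ENNReal.ofReal t < ENNReal.ofReal b} ∩ Set.Ioi 0 = Set.Ioo 0 b := by
      ext t
      simp only [Set.mem_inter_iff, Set.mem_ofPred_eq, Set.mem_Ioi, Set.mem_Ioo]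
      constructor
      · rintro ⟨h1, h2⟩
        exact ⟨h2, (ofReal_lt_ofReal_iff_of_nonneg h2.le).1 h1⟩
      · rintro ⟨h1, h2⟩
        exact ⟨(ofReal_lt_ofReal_iff_of_nonneg h1.le).2 h2, h1⟩
    rw [hset, Measure.restrict_congr_set Ioo_ae_eq_Ioc, ← ofReal_integral_eq_lintegral_ofReal,
      ← intervalIntegral.integral_of_le hb, integral_rpow (Or.inl (by linarith)),
      ofReal_rpow_of_nonneg hb ha.le, ← ENNReal.ofReal_mul (by positivity)]
    · congr 1
      rw [sub_add_cancel, Real.zero_rpow ha.ne', sub_zero, one_div, div_eq_inv_mul]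
    · exact (intervalIntegrable_iff_integrableOn_Ioc_of_le hb).1
        (intervalIntegral.intervalIntegrable_rpow' (by linarith))
    · filter_upwards [ae_restrict_mem measurableSet_Ioc] with t ht
      exact Real.rpow_nonneg ht.1.le _
  rcases eq_or_ne y ∞ with rfl | hy
  · have ha' : ENNReal.ofReal (1 / a) ≠ 0 := (ofReal_pos.2 (by positivity)).ne'
    rw [top_rpow_of_pos ha, mul_top ha']
    refine ENNReal.eq_top_of_forall_nnreal_le fun R => ?_
    have hb : 0 ≤ (a * (R : ℝ)) ^ (1 / a) := by positivity
    calc (R : ℝ≥0∞) = ENNReal.ofReal (1 / a) * ENNReal.ofReal ((a * (R : ℝ)) ^ (1 / a)) ^ a := by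
          rw [ofReal_rpow_of_nonneg hb ha.le, ← Real.rpow_mul (by positivity),
            one_div_mul_cancel ha.ne', Real.rpow_one, ← ENNReal.ofReal_mul (by positivity),
            ← mul_assoc, one_div_mul_cancel ha.ne', one_mul, ofReal_coe_nnreal]
      _ ≤ _ := by
          rw [← hfin _ hb]
          refine lintegral_mono fun t => Set.indicator_le_indicator_of_subset ?_ (by simp) t
          intro t ht
          exact (show ENNReal.ofReal t < _ from ht).trans_le le_top
  · have := hfin y.toReal toReal_nonneg
    rwa [ofReal_toReal hy] at this

theorem maximalFn_le_add {μ : Measure X} (g : X → ℝ≥0∞) (hg : Measurable g) (t : ℝ≥0∞) (x : X) :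
    maximalFn μ g x ≤ maximalFn μ ({y | t < g y}.indicator g) x + t := by
  refine iSup₂_le fun z r => iSup₂_le fun hr hx => ?_
  have hm : MeasurableSet {y | t < g y} := measurableSet_lt measurable_const hg
  calc (μ (ball z r))⁻¹ * ∫⁻ y in ball z r, g y ∂μ
      ≤ (μ (ball z r))⁻¹ * ∫⁻ y in ball z r, ({y | t < g y}.indicator g y + t) ∂μ := by
        gcongr with y
        by_cases hy : t < g y
        · simp [Set.indicator, hy]
        · simpa [Set.indicator, hy] using not_lt.1 hy
    _ = (μ (ball z r))⁻¹ * ∫⁻ y in ball z r, {y | t < g y}.indicator g y ∂μ +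
          t * ((μ (ball z r))⁻¹ * μ (ball z r)) := by
        rw [lintegral_add_right _ measurable_const, lintegral_const, Measure.restrict_apply_univ]
        ring
    _ ≤ _ := by
        refine add_le_add (laverage_le_maximalFn μ _ x hr hx) ?_
        exact (mul_le_mul_right (ENNReal.inv_mul_le_one _) _).trans_eq (mul_one t)

/-- Strong type `(s,s)` estimate for the maximal function. -/
theorem lintegral_maximalFn_rpow_le {μ : Measure X} {c₁ c₂ ν : ℝ} (hA : IsAhlfors μ c₁ c₂ ν)
    (hc₁ : 0 < c₁) (hc₂ : 0 < c₂) (hν : 0 < ν) {s : ℝ} (hs : 1 < s) :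
    ∃ C : ℝ≥0∞, C ≠ ∞ ∧ ∀ g : X → ℝ≥0∞, Measurable g →
      ∫⁻ x, maximalFn μ g x ^ s ∂μ ≤ C * ∫⁻ x, g x ^ s ∂μ := by
  have := hA.sigmaFinite
  have hs0 : 0 < s := by linarith
  have hs1 : 0 < s - 1 := by linarith
  set D := ENNReal.ofReal (c₂ / c₁ * 6 ^ ν)
  refine ⟨ENNReal.ofReal s * (2 * D * (ENNReal.ofReal (1 / (s - 1)) * 2 ^ (s - 1))),
    by finiteness, fun g hg => ?_⟩
  have hM := measurable_maximalFn μ g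
  have hlevel : ∀ t : ℝ, 0 < t → ENNReal.ofReal (t ^ (s - 1)) *
      μ {x | ENNReal.ofReal t < maximalFn μ g x} ≤
      2 * D * ∫⁻ x, g x * {t : ℝ | ENNReal.ofReal t < 2 * g x}.indicator
        (fun t => ENNReal.ofReal (t ^ (s - 1 - 1))) t ∂μ := by
    intro t ht
    set τ := ENNReal.ofReal (t / 2) with hτ
    have hτ2 : ENNReal.ofReal t = τ + τ := by
      rw [hτ, ← ofReal_add (by positivity) (by positivity), add_halves]
    have hτ0 : τ ≠ 0 := (ofReal_pos.2 (by positivity)).ne'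
    have hsub : {x | ENNReal.ofReal t < maximalFn μ g x} ⊆
        {x | τ < maximalFn μ ({y | τ < g y}.indicator g) x} := by
      intro x hx
      have h1 : τ + τ < maximalFn μ ({y | τ < g y}.indicator g) x + τ := by
        rw [← hτ2]
        exact lt_of_lt_of_le hx (maximalFn_le_add g hg τ x)
      exact lt_of_add_lt_add_right h1
    have hweak := mul_measure_lt_maximalFn_le hA hc₁ hc₂ hν ({y | τ < g y}.indicator g) hτ0
      ofReal_ne_top
    calc ENNReal.ofReal (t ^ (s - 1)) * μ {x | ENNReal.ofReal t < maximalFn μ g x}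
        = ENNReal.ofReal (t ^ (s - 1 - 1)) *
            (2 * (τ * μ {x | ENNReal.ofReal t < maximalFn μ g x})) := by
          have : t ^ (s - 1) = t ^ (s - 1 - 1) * t := by
            rw [← Real.rpow_add_one ht.ne', sub_add_cancel]
          rw [this, ENNReal.ofReal_mul (by positivity), hτ2]
          ring
      _ ≤ ENNReal.ofReal (t ^ (s - 1 - 1)) * (2 * (D * ∫⁻ x, {y | τ < g y}.indicator g x ∂μ)) := by
          exact mul_le_mul_right (mul_le_mul_right
            ((mul_le_mul_right (measure_mono hsub) _).trans hweak) _) _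
      _ = 2 * D * ∫⁻ x, ENNReal.ofReal (t ^ (s - 1 - 1)) * {y | τ < g y}.indicator g x ∂μ := by
          rw [lintegral_const_mul' _ _ ofReal_ne_top]; ring
      _ = _ := by
          congr 2
          ext x
          have hiff : τ < g x ↔ ENNReal.ofReal t < 2 * g x := by
            rw [hτ2, ← two_mul, ENNReal.mul_lt_mul_iff_right two_ne_zero ofNat_ne_top]
          by_cases hx : τ < g x
          · have hx' := hiff.1 hx
            simp only [Set.indicator, Set.mem_ofPred_eq, hx, hx', if_true]
            exact mul_comm _ _
          · have hx' : ¬ ENNReal.ofReal t < 2 * g x := fun h => hx (hiff.2 h)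
            simp only [Set.indicator, Set.mem_ofPred_eq, hx, hx', if_false, mul_zero]
  have hind : ∀ {F : X → ℝ≥0∞} {a : ℝ}, Measurable F → Measurable fun z : X × ℝ =>
      {t : ℝ | ENNReal.ofReal t < F z.1}.indicator (fun t => ENNReal.ofReal (t ^ a)) z.2 := by
    intro F a hF
    have h1 : Measurable fun z : X × ℝ => ENNReal.ofReal (z.2 ^ a) := by fun_prop
    exact h1.indicator (measurableSet_lt (measurable_ofReal.comp measurable_snd)
      (hF.comp measurable_fst))
  have hs' : ENNReal.ofReal s * ENNReal.ofReal (1 / s) = 1 := by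
    rw [← ENNReal.ofReal_mul hs0.le, mul_one_div_cancel hs0.ne', ofReal_one]
  calc ∫⁻ x, maximalFn μ g x ^ s ∂μ
      = ENNReal.ofReal s * ∫⁻ x, ENNReal.ofReal (1 / s) * maximalFn μ g x ^ s ∂μ := by
        rw [← lintegral_const_mul' _ _ ofReal_ne_top]
        simp only [← mul_assoc, hs', one_mul]
    _ = ENNReal.ofReal s * ∫⁻ t in Set.Ioi (0 : ℝ), ENNReal.ofReal (t ^ (s - 1)) *
          μ {x | ENNReal.ofReal t < maximalFn μ g x} := by
        simp only [← lintegral_Ioi_indicator_rpow hs0]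
        rw [lintegral_lintegral_swap (hind hM).aemeasurable]
        congr 2
        ext t
        rw [← lintegral_indicator_const (measurableSet_lt measurable_const hM)]
        rfl
    _ ≤ ENNReal.ofReal s * ∫⁻ t in Set.Ioi (0 : ℝ), 2 * D * ∫⁻ x, g x *
          {t : ℝ | ENNReal.ofReal t < 2 * g x}.indicator
            (fun t => ENNReal.ofReal (t ^ (s - 1 - 1))) t ∂μ := by
        refine mul_le_mul_right (setLIntegral_mono' measurableSet_Ioi fun t ht => hlevel t ht) _
    _ = ENNReal.ofReal s * (2 * D * ∫⁻ x, g x *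
          (ENNReal.ofReal (1 / (s - 1)) * (2 * g x) ^ (s - 1)) ∂μ) := by
        simp only [← lintegral_Ioi_indicator_rpow hs1]
        rw [lintegral_const_mul' _ _ (by finiteness), ← lintegral_lintegral_swap]
        · congr 3
          ext x
          rw [lintegral_const_mul]
          exact (hind (hg.const_mul 2)).comp measurable_prodMk_left
        · exact ((hg.comp measurable_fst).mul (hind (hg.const_mul 2))).aemeasurable
    _ = _ := by
        have : ∀ x, g x * (ENNReal.ofReal (1 / (s - 1)) * (2 * g x) ^ (s - 1)) =
            ENNReal.ofReal (1 / (s - 1)) * 2 ^ (s - 1) * g x ^ s := by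
          intro x
          have h1 : g x ^ s = g x * g x ^ (s - 1) := by
            conv_lhs => rw [show s = 1 + (s - 1) by ring,
              ENNReal.rpow_add_of_nonneg _ _ zero_le_one hs1.le, rpow_one]
          rw [mul_rpow_of_nonneg _ _ hs1.le, h1]
          ring
        simp only [this]
        rw [lintegral_const_mul' _ _ (by finiteness)]
        ring

theorem ENNReal.rpow_neg_le_mul_rpow_neg {a m D : ℝ≥0∞} (hD0 : D ≠ 0) (hD : D ≠ ∞) {e : ℝ}
    (he : 0 ≤ e) (h : a ≤ D * m) : m ^ (-e) ≤ D ^ e * a ^ (-e) := by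
  have h0 : D ^ e ≠ 0 := (ENNReal.rpow_pos (pos_iff_ne_zero.2 hD0) hD).ne'
  have h1 : D ^ e ≠ ∞ := by finiteness
  calc m ^ (-e) = D ^ e * (D * m) ^ (-e) := by
        rw [ENNReal.rpow_neg, ENNReal.rpow_neg, mul_rpow_of_nonneg _ _ he,
          ENNReal.mul_inv (Or.inl h0) (Or.inl h1), ← mul_assoc, ENNReal.mul_inv_cancel h0 h1,
          one_mul]
    _ ≤ _ := by
        rw [ENNReal.rpow_neg, ENNReal.rpow_neg]
        gcongr

theorem mul_lintegral_rpow_le_morreyNorm_rpow {μ : Measure X} (g : X → ℝ≥0∞) {s t : ℝ}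
    (hs : 0 < s) (z : X) {r : ℝ} (hr : 0 < r) :
    μ (ball z r) ^ (s / t - 1) * ∫⁻ y in ball z r, g y ^ s ∂μ ≤ morreyNorm μ s t g ^ s := by
  have hle : (μ (ball z r) ^ (s / t - 1) * ∫⁻ y in ball z r, g y ^ s ∂μ) ^ (1 / s) ≤
      morreyNorm μ s t g :=
    le_iSup₂_of_le z r (le_iSup_of_le hr le_rfl)
  have := ENNReal.rpow_le_rpow hle hs.le
  rwa [← ENNReal.rpow_mul, one_div_mul_cancel hs.ne', rpow_one] at this

/-- Boundedness of the maximal function on Morrey spaces. -/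
theorem mul_lintegral_maximalFn_rpow_le {μ : Measure X} {c₁ c₂ ν : ℝ} (hA : IsAhlfors μ c₁ c₂ ν)
    (hc₁ : 0 < c₁) (hc₂ : 0 < c₂) (hν : 0 < ν) {s t : ℝ} (hs : 1 < s) (hst : s ≤ t) :
    ∃ C : ℝ≥0∞, C ≠ ∞ ∧ ∀ g : X → ℝ≥0∞, Measurable g → ∀ (z : X) (r : ℝ), 0 < r →
      μ (ball z r) ^ (s / t - 1) * ∫⁻ x in ball z r, maximalFn μ g x ^ s ∂μ ≤
        C * morreyNorm μ s t g ^ s := by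
  obtain ⟨C, hC, hstrong⟩ := lintegral_maximalFn_rpow_le hA hc₁ hc₂ hν hs
  have hs0 : 0 < s := by linarith
  have ht0 : 0 < t := by linarith
  have hst1 : 0 ≤ 1 - s / t := by rw [sub_nonneg, div_le_one ht0]; exact hst
  set D := ENNReal.ofReal (c₂ / c₁ * 1 ^ ν)
  set E := ENNReal.ofReal (c₂ / c₁ * 4 ^ ν)
  have hD0 : D ≠ 0 := (ofReal_pos.2 (by positivity)).ne'
  refine ⟨2 ^ (s - 1) * (C * E ^ (1 - s / t) + D ^ (s / t)), by finiteness, fun g hg z r hr => ?_⟩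
  set B := ball z r
  set N := morreyNorm μ s t g
  have hB0 : μ B ≠ 0 := (hA.measure_ball_pos hc₁ z hr).ne'
  have hB : μ B ≠ ∞ := (hA.measure_ball_lt_top z r).ne
  set g₁ := (ball z (4 * r)).indicator g with hg₁
  have hpt : ∀ x ∈ B, maximalFn μ g x ≤
      maximalFn μ g₁ x + D ^ (1 / t) * μ B ^ (-(1 / t)) * N := by
    intro x hx
    refine iSup₂_le fun w ρ => iSup₂_le fun hρ hxw => ?_
    rcases le_or_gt ρ r with h | h
    · refine le_add_right (le_trans (le_of_eq ?_) (laverage_le_maximalFn μ g₁ x hρ hxw))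
      congr 1
      refine setLIntegral_congr_fun measurableSet_ball fun y hy => ?_
      have hy' : y ∈ ball z (4 * r) := by
        have h1 := dist_triangle4 y w x z
        rw [mem_ball] at hy hxw ⊢
        have h2 : dist x z < r := hx
        rw [dist_comm w x] at h1
        linarith
      simp [hg₁, hy']
    · refine le_add_left ((laverage_le_morreyNorm (t := t) g hs w hρ
        (hA.measure_ball_pos hc₁ w hρ).ne' (hA.measure_ball_lt_top w ρ).ne).trans ?_)
      refine mul_le_mul_left (ENNReal.rpow_neg_le_mul_rpow_neg hD0 ofReal_ne_top (by positivity)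
        (hA.measure_ball_le_mul hc₁ hc₂ one_pos z w hρ (by linarith))) _
  have hlocal : ∫⁻ x, maximalFn μ g₁ x ^ s ∂μ ≤
      C * (E ^ (1 - s / t) * μ B ^ (1 - s / t) * N ^ s) := by
    have h4 : 0 < 4 * r := by positivity
    have hm0 : μ (ball z (4 * r)) ≠ 0 := (hA.measure_ball_pos hc₁ z h4).ne'
    have hm : μ (ball z (4 * r)) ≠ ∞ := (hA.measure_ball_lt_top z (4 * r)).ne
    refine (hstrong g₁ (hg.indicator measurableSet_ball)).trans (mul_le_mul_right ?_ _)
    calc ∫⁻ x, g₁ x ^ s ∂μ = ∫⁻ x in ball z (4 * r), g x ^ s ∂μ := by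
          rw [← lintegral_indicator measurableSet_ball]
          congr 1
          ext x
          by_cases hx : x ∈ ball z (4 * r)
          · simp only [hg₁, Set.indicator_of_mem hx]
          · simp only [hg₁, Set.indicator_of_notMem hx, zero_rpow_of_pos hs0]
      _ = μ (ball z (4 * r)) ^ (1 - s / t) *
            (μ (ball z (4 * r)) ^ (s / t - 1) * ∫⁻ x in ball z (4 * r), g x ^ s ∂μ) := by
          rw [← mul_assoc, ← ENNReal.rpow_add _ _ hm0 hm]
          simp
      _ ≤ (E * μ B) ^ (1 - s / t) * N ^ s := by
          gcongr
          · exact hA.measure_ball_le_mul hc₁ hc₂ (by norm_num) z z hr le_rfl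
          · exact mul_lintegral_rpow_le_morreyNorm_rpow g hs0 z h4
      _ = _ := by rw [mul_rpow_of_nonneg _ _ hst1]
  have hM₁ := (measurable_maximalFn μ g₁).pow_const s
  calc μ B ^ (s / t - 1) * ∫⁻ x in B, maximalFn μ g x ^ s ∂μ
      ≤ μ B ^ (s / t - 1) * ∫⁻ x in B, 2 ^ (s - 1) * (maximalFn μ g₁ x ^ s +
          (D ^ (1 / t) * μ B ^ (-(1 / t)) * N) ^ s) ∂μ := by
        refine mul_le_mul_right (setLIntegral_mono' measurableSet_ball fun x hx => ?_) _
        exact (ENNReal.rpow_le_rpow (hpt x hx) hs0.le).trans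
          (ENNReal.rpow_add_le_mul_rpow_add_rpow _ _ hs.le)
    _ = μ B ^ (s / t - 1) * (2 ^ (s - 1) * (∫⁻ x in B, maximalFn μ g₁ x ^ s ∂μ +
          D ^ (s / t) * μ B ^ (-(s / t)) * N ^ s * μ B)) := by
        rw [lintegral_const_mul' _ _ (by finiteness), lintegral_add_right _ measurable_const,
          lintegral_const, Measure.restrict_apply_univ, mul_rpow_of_nonneg _ _ hs0.le,
          mul_rpow_of_nonneg _ _ hs0.le, ← ENNReal.rpow_mul, ← ENNReal.rpow_mul]
        congr 7 <;> field_simp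
    _ ≤ μ B ^ (s / t - 1) * (2 ^ (s - 1) * (C * (E ^ (1 - s / t) * μ B ^ (1 - s / t) * N ^ s) +
          D ^ (s / t) * μ B ^ (-(s / t)) * N ^ s * μ B)) := by
        gcongr
        exact (setLIntegral_le_lintegral _ _).trans hlocal
    _ = 2 ^ (s - 1) * (C * E ^ (1 - s / t) * (μ B ^ (s / t - 1) * μ B ^ (1 - s / t)) +
          D ^ (s / t) * (μ B ^ (s / t - 1) * μ B ^ (-(s / t)) * μ B ^ (1 : ℝ))) * N ^ s := by
        rw [rpow_one]; ring
    _ = _ := by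
        rw [← ENNReal.rpow_add _ _ hB0 hB, ← ENNReal.rpow_add _ _ hB0 hB,
          ← ENNReal.rpow_add _ _ hB0 hB, show s / t - 1 + (1 - s / t) = 0 by ring,
          show s / t - 1 + -(s / t) + 1 = 0 by ring, ENNReal.rpow_zero, mul_one, mul_one]

theorem Real.exists_sum_min_dyadic_le {β : ℝ} (hβ : 1 < β) :
    ∃ C : ℝ, 0 < C ∧ ∀ (u : ℝ), 0 < u → ∀ n : ℕ,
      ∑ k ∈ Finset.range n, min (u * 2 ^ k) ((u * 2 ^ k) ^ (1 - β)) ≤ C := by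
  set δ := min 1 (β - 1) with hδ
  have hδ0 : 0 < δ := lt_min one_pos (by linarith)
  set c : ℝ := 2 ^ δ with hc
  have hc1 : 1 < c := Real.one_lt_rpow one_lt_two hδ0
  have hc1' : 0 < c - 1 := by linarith
  set L := 2 * (1 + c) / (c - 1) with hL
  refine ⟨L, by positivity, fun u hu n => ?_⟩
  let ψ : ℕ → ℝ := fun k => (u * 2 ^ k) ^ δ / (1 + (u * 2 ^ k) ^ δ)
  have hterm : ∀ k : ℕ, min (u * 2 ^ k) ((u * 2 ^ k) ^ (1 - β)) ≤ L * (ψ (k + 1) - ψ k) := by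
    intro k
    have hw : 0 < u * 2 ^ k := by positivity
    have hsucc : (u * 2 ^ (k + 1)) ^ δ = c * (u * 2 ^ k) ^ δ := by
      rw [pow_succ, ← mul_assoc, mul_comm _ (2 : ℝ), Real.mul_rpow (by norm_num) hw.le]
    simp only [ψ, hsucc]
    set w := u * 2 ^ k
    set v := w ^ δ with hv
    have hv0 : 0 < v := by positivity
    have hdiff : L * (c * v / (1 + c * v) - v / (1 + v)) =
        2 * (1 + c) * v / ((1 + v) * (1 + c * v)) := by
      rw [hL]
      field_simp
      ring
    rw [hdiff]
    rcases le_total w 1 with h | h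
    · have hwv : w ≤ v := by
        simpa using Real.rpow_le_rpow_of_exponent_ge hw h (min_le_left 1 (β - 1))
      have hv1 : v ≤ 1 := Real.rpow_le_one hw.le h hδ0.le
      refine (min_le_left _ _).trans (hwv.trans ?_)
      rw [le_div_iff₀ (by positivity), mul_comm (2 * (1 + c))]
      gcongr ?_ * (?_ * ?_) <;> nlinarith
    · have hwv : w ^ (1 - β) ≤ v⁻¹ := by
        rw [hv, ← Real.rpow_neg hw.le]
        exact Real.rpow_le_rpow_of_exponent_le h (by linarith [min_le_right 1 (β - 1)])
      have hv1 : 1 ≤ v := Real.one_le_rpow h hδ0.le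
      refine (min_le_right _ _).trans (hwv.trans ?_)
      rw [le_div_iff₀ (by positivity), inv_mul_le_iff₀ hv0]
      have h1 : 1 + v ≤ 2 * v := by linarith
      have h2 : 1 + c * v ≤ (1 + c) * v := by linarith
      calc (1 + v) * (1 + c * v) ≤ (2 * v) * ((1 + c) * v) := by gcongr
        _ = _ := by ring
  calc ∑ k ∈ Finset.range n, min (u * 2 ^ k) ((u * 2 ^ k) ^ (1 - β))
      ≤ ∑ k ∈ Finset.range n, L * (ψ (k + 1) - ψ k) := Finset.sum_le_sum fun k _ => hterm k
    _ = L * (ψ n - ψ 0) := by rw [← Finset.mul_sum, Finset.sum_range_sub]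
    _ ≤ L * 1 := by
        have h0 : 0 ≤ ψ 0 := by positivity
        have h1 : ψ n ≤ 1 := by
          simp only [ψ]
          rw [div_le_one (by positivity)]
          linarith
        gcongr
        linarith
    _ = L := mul_one L

/-- Hedberg's interpolation argument, summed over dyadic scales. -/
theorem ENNReal.exists_tsum_dyadic_le {β : ℝ} (hβ : 1 < β) :
    ∃ C : ℝ, 0 < C ∧ ∀ (R : ℝ) (M A : ℝ≥0∞) (a : ℕ → ℝ≥0∞), 0 < R → A ≠ ∞ → (∀ k, a k ≤ M) →
      (∀ k, a k ≤ A * ENNReal.ofReal (R * 2 ^ k) ^ (-β)) →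
      ∑' k, ENNReal.ofReal (R * 2 ^ k) * a k ≤
        ENNReal.ofReal C * (M ^ (1 - 1 / β) * A ^ (1 / β)) := by
  obtain ⟨C, hC, hsum⟩ := Real.exists_sum_min_dyadic_le hβ
  have hβ0 : 0 < β := by linarith
  have hβ1 : 0 < 1 - 1 / β := by rw [sub_pos, div_lt_one hβ0]; exact hβ
  refine ⟨C, hC, fun R M A a hR hA haM haA => ?_⟩
  rcases eq_or_ne A 0 with rfl | hA0
  · have : ∀ k, a k = 0 := fun k => by simpa using haA k
    simp [this]
  rcases eq_or_ne M 0 with rfl | hM0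
  · have : ∀ k, a k = 0 := fun k => by simpa using haM k
    simp [this]
  rcases eq_or_ne M ∞ with rfl | hM
  · have h1 : A ^ (1 / β) ≠ 0 := (ENNReal.rpow_pos (pos_iff_ne_zero.2 hA0) hA).ne'
    rw [top_rpow_of_pos hβ1, top_mul h1, mul_top (ofReal_pos.2 hC).ne']
    exact le_top
  lift M to NNReal using hM
  lift A to NNReal using hA
  have hm : (0 : ℝ) < M := by exact_mod_cast pos_iff_ne_zero.2 hM0
  have hA' : (0 : ℝ) < A := by exact_mod_cast pos_iff_ne_zero.2 hA0
  set m : ℝ := (M : ℝ)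
  set α : ℝ := (A : ℝ)
  have hMm : (M : ℝ≥0∞) = ENNReal.ofReal m := (ofReal_coe_nnreal).symm
  have hAα : (A : ℝ≥0∞) = ENNReal.ofReal α := (ofReal_coe_nnreal).symm
  set ρ : ℝ := (α / m) ^ (1 / β) with hρ
  have hρ0 : 0 < ρ := by positivity
  have hρm : m * ρ = m ^ (1 - 1 / β) * α ^ (1 / β) := by
    rw [hρ, Real.div_rpow hA'.le hm.le, Real.rpow_sub hm, Real.rpow_one]
    ring
  have hρβ : ρ ^ (1 - β) = ρ * (m / α) := by
    rw [Real.rpow_sub hρ0, Real.rpow_one, hρ, ← Real.rpow_mul (by positivity),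
      one_div_mul_cancel hβ0.ne', Real.rpow_one]
    field_simp
  refine ENNReal.tsum_le_of_sum_range_le fun n => ?_
  have hterm : ∀ k : ℕ, ENNReal.ofReal (R * 2 ^ k) * a k ≤
      ENNReal.ofReal (m * ρ * min (R / ρ * 2 ^ k) ((R / ρ * 2 ^ k) ^ (1 - β))) := by
    intro k
    have hw : 0 < R * 2 ^ k := by positivity
    have hw' : R / ρ * 2 ^ k = R * 2 ^ k / ρ := by ring
    rw [hw']
    set w := R * 2 ^ k
    rw [mul_min_of_nonneg _ _ (by positivity), ENNReal.ofReal_min]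
    refine le_min ?_ ?_
    · calc ENNReal.ofReal w * a k ≤ ENNReal.ofReal w * ENNReal.ofReal m := by
            rw [← hMm]; gcongr; exact haM k
        _ = _ := by
            rw [← ENNReal.ofReal_mul hw.le]
            congr 1
            field_simp
    · calc ENNReal.ofReal w * a k
          ≤ ENNReal.ofReal w * (ENNReal.ofReal α * ENNReal.ofReal w ^ (-β)) := by
            rw [← hAα]; gcongr; exact haA k
        _ = _ := by
            rw [ENNReal.ofReal_rpow_of_pos hw, ← ENNReal.ofReal_mul hA'.le,
              ← ENNReal.ofReal_mul hw.le]
            congr 1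
            rw [Real.div_rpow hw.le hρ0.le, hρβ, Real.rpow_sub hw, Real.rpow_one,
              Real.rpow_neg hw.le]
            field_simp
  calc ∑ k ∈ Finset.range n, ENNReal.ofReal (R * 2 ^ k) * a k
      ≤ ∑ k ∈ Finset.range n,
          ENNReal.ofReal (m * ρ * min (R / ρ * 2 ^ k) ((R / ρ * 2 ^ k) ^ (1 - β))) :=
        Finset.sum_le_sum fun k _ => hterm k
    _ = ENNReal.ofReal (m * ρ * ∑ k ∈ Finset.range n,
          min (R / ρ * 2 ^ k) ((R / ρ * 2 ^ k) ^ (1 - β))) := by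
        rw [← ENNReal.ofReal_sum_of_nonneg fun k _ => by positivity, Finset.mul_sum]
    _ ≤ ENNReal.ofReal (m * ρ * C) := by
        gcongr
        exact hsum _ (by positivity) n
    _ = _ := by
        rw [hMm, hAα, ENNReal.ofReal_rpow_of_pos hm, ENNReal.ofReal_rpow_of_pos hA',
          ← ENNReal.ofReal_mul (by positivity), ← ENNReal.ofReal_mul hC.le, hρm]
        congr 1
        ring

theorem measurableSet_annulus (x : X) (a b : ℝ) :
    MeasurableSet {y : X | a < dist x y ∧ dist x y ≤ b} := by
  have h : Continuous fun y : X => dist x y := by fun_prop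
  exact (measurableSet_lt measurable_const h.measurable).inter
    (measurableSet_le h.measurable measurable_const)

theorem SizeCond.norm_le {K : X → X → ℝ} {CK ν : ℝ} (hsize : SizeCond K CK ν) (hCK : 0 < CK)
    (hν : 0 < ν) {x y : X} {a : ℝ} (ha : 0 < a) (hy : a < dist x y) :
    ‖K x y‖ ≤ CK / a ^ ν := by
  have hxy : x ≠ y := dist_pos.1 (ha.trans hy)
  refine (hsize x y hxy).trans ?_
  gcongr

theorem integrableOn_kernel {μ : Measure X} {c₁ c₂ ν CK : ℝ} {K : X → X → ℝ}
    (hA : IsAhlfors μ c₁ c₂ ν) (hν : 0 < ν) (hK : Measurable (Function.uncurry K)) (hCK : 0 < CK)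
    (hsize : SizeCond K CK ν) (x : X) {a b : ℝ} (ha : 0 < a) {s : Set X} (hs : MeasurableSet s)
    (hsub : ∀ y ∈ s, a < dist x y ∧ dist x y < b) : IntegrableOn (K x) s μ := by
  refine Measure.integrableOn_of_bounded (M := CK / a ^ ν) ?_
    (hK.comp measurable_prodMk_left).aestronglyMeasurable ?_
  · refine (measure_mono (t := ball x b) fun y hy => ?_).trans_lt
      (hA.measure_ball_lt_top x b) |>.ne
    rw [mem_ball']
    exact (hsub y hy).2
  · filter_upwards [ae_restrict_mem hs] with y hy
    exact hsize.norm_le hCK hν ha (hsub y hy).1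

theorem setIntegral_annulus_eq_zero {μ : Measure X} {c₁ c₂ ν CK : ℝ} {K : X → X → ℝ}
    (hA : IsAhlfors μ c₁ c₂ ν) (hν : 0 < ν) (hK : Measurable (Function.uncurry K)) (hCK : 0 < CK)
    (hsize : SizeCond K CK ν) (hnull : NullCond μ K) (x : X) {a b : ℝ} (ha : 0 < a) (hab : a < b) :
    ∫ y in {y | a < dist x y ∧ dist x y ≤ b}, K x y ∂μ = 0 := by
  let s : ℕ → Set X := fun n => {y | a < dist x y ∧ dist x y < b + 1 / ((n : ℝ) + 1)}
  have hcont : Continuous fun y : X => dist x y := by fun_prop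
  have hs : ∀ n, MeasurableSet (s n) := fun n =>
    (measurableSet_lt measurable_const hcont.measurable).inter
      (measurableSet_lt hcont.measurable measurable_const)
  have hanti : Antitone s := fun m n hmn y hy =>
    ⟨hy.1, hy.2.trans_le (by have := Nat.one_div_le_one_div (α := ℝ) hmn; linarith)⟩
  have hinter : ⋂ n, s n = {y | a < dist x y ∧ dist x y ≤ b} := by
    ext y
    simp only [s, Set.mem_iInter, Set.mem_ofPred_eq]
    constructor
    · intro h
      have hb : Filter.Tendsto (fun n : ℕ => b + 1 / ((n : ℝ) + 1)) Filter.atTop (nhds b) := by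
        simpa using tendsto_one_div_add_atTop_nhds_zero_nat.const_add b
      exact ⟨(h 0).1, ge_of_tendsto' hb fun n => (h n).2.le⟩
    · rintro ⟨h1, h2⟩ n
      exact ⟨h1, h2.trans_lt (by have := Nat.one_div_pos_of_nat (α := ℝ) (n := n); linarith)⟩
  have hlim := tendsto_setIntegral_of_antitone (f := K x) (μ := μ) hs hanti
    ⟨0, integrableOn_kernel hA hν hK hCK hsize x ha (hs 0) fun y hy => hy⟩
  rw [hinter] at hlim
  have hzero : ∀ n, ∫ y in s n, K x y ∂μ = 0 := fun n =>
    hnull x a _ ha (by have := Nat.one_div_pos_of_nat (α := ℝ) (n := n); linarith)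
  simp only [hzero] at hlim
  exact tendsto_nhds_unique hlim tendsto_const_nhds

/-- The contribution of a single dyadic annulus to the truncated singular integral. -/
theorem enorm_setIntegral_annulus_le {μ : Measure X} {c₁ c₂ ν CK CP σ ρ' : ℝ} {K : X → X → ℝ}
    {f : X → ℝ} {g : X → ℝ≥0∞} (hc₁ : 0 < c₁) (hc₂ : 0 < c₂) (hA : IsAhlfors μ c₁ c₂ ν)
    (hν : 0 < ν) (hK : Measurable (Function.uncurry K)) (hCK : 0 < CK)
    (hsize : SizeCond K CK ν) (hnull : NullCond μ K) (hρ' : 1 < ρ') (hCP : 0 < CP)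
    (hPS : PoincareSobolev μ f g ρ' CP σ) (x : X) {r : ℝ} (hr : 0 < r)
    (hint : IntegrableOn (fun y => K x y * f y) {y | r < dist x y ∧ dist x y ≤ 2 * r} μ) :
    ‖∫ y in {y | r < dist x y ∧ dist x y ≤ 2 * r}, K x y * f y ∂μ‖ₑ ≤
      ENNReal.ofReal (CK * c₂ * 4 ^ ν * CP) * (ENNReal.ofReal (4 * r) *
        ((μ (ball x (σ * (4 * r))))⁻¹ * ∫⁻ y in ball x (σ * (4 * r)), g y ∂μ)) := by
  set S := {y | r < dist x y ∧ dist x y ≤ 2 * r}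
  have hS : MeasurableSet S := measurableSet_annulus x r (2 * r)
  have h4 : 0 < 4 * r := by positivity
  set B := ball x (4 * r)
  have hSB : S ⊆ B := fun y hy => by
    rw [mem_ball']
    have := hy.2
    linarith
  have hB0 : μ B ≠ 0 := (hA.measure_ball_pos hc₁ x h4).ne'
  have hB : μ B ≠ ∞ := (hA.measure_ball_lt_top x (4 * r)).ne
  set c := ⨍ z in B, f z ∂μ
  have hKint : IntegrableOn (K x) S μ :=
    integrableOn_kernel hA hν hK hCK hsize x hr hS (b := 4 * r) fun y hy =>
      ⟨hy.1, by have := hy.2; linarith⟩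
  have hK0 : ∫ y in S, K x y ∂μ = 0 :=
    setIntegral_annulus_eq_zero hA hν hK hCK hsize hnull x hr (by linarith)
  have heq : ∫ y in S, K x y * f y ∂μ = ∫ y in S, K x y * (f y - c) ∂μ := by
    simp only [mul_sub]
    rw [integral_sub hint (hKint.mul_const c), integral_mul_const, hK0, zero_mul, sub_zero]
  have hpoin : (μ B)⁻¹ * ∫⁻ y in B, ENNReal.ofReal |f y - c| ∂μ ≤ ENNReal.ofReal (CP * (4 * r)) *
      ((μ (ball x (σ * (4 * r))))⁻¹ * ∫⁻ y in ball x (σ * (4 * r)), g y ∂μ) := by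
    refine (laverage_le_rpow hB0 hB _ hρ').trans (le_trans (le_of_eq ?_) (hPS x (4 * r) h4))
    simp only [ENNReal.ofReal_rpow_of_nonneg (abs_nonneg _) (zero_le_one.trans hρ'.le)]
    rfl
  rw [heq]
  set G := (μ (ball x (σ * (4 * r))))⁻¹ * ∫⁻ y in ball x (σ * (4 * r)), g y ∂μ
  calc ‖∫ y in S, K x y * (f y - c) ∂μ‖ₑ
      ≤ ∫⁻ y in S, ‖K x y * (f y - c)‖ₑ ∂μ := enorm_integral_le_lintegral_enorm _
    _ ≤ ∫⁻ y in S, ENNReal.ofReal (CK / r ^ ν) * ENNReal.ofReal |f y - c| ∂μ := by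
        refine setLIntegral_mono' hS fun y hy => ?_
        rw [← ENNReal.ofReal_mul (by positivity), ← ofReal_norm, norm_mul]
        refine ENNReal.ofReal_le_ofReal ?_
        gcongr
        · exact hsize.norm_le hCK hν hr hy.1
        · exact (Real.norm_eq_abs _).le
    _ = ENNReal.ofReal (CK / r ^ ν) * ∫⁻ y in S, ENNReal.ofReal |f y - c| ∂μ :=
        lintegral_const_mul' _ _ ofReal_ne_top
    _ ≤ ENNReal.ofReal (CK / r ^ ν) * ∫⁻ y in B, ENNReal.ofReal |f y - c| ∂μ :=
        mul_le_mul_right (lintegral_mono_set hSB) _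
    _ = ENNReal.ofReal (CK / r ^ ν) * (μ B * ((μ B)⁻¹ *
          ∫⁻ y in B, ENNReal.ofReal |f y - c| ∂μ)) := by
        rw [← mul_assoc (μ B), ENNReal.mul_inv_cancel hB0 hB, one_mul]
    _ ≤ ENNReal.ofReal (CK / r ^ ν) * (ENNReal.ofReal (c₂ * (4 * r) ^ ν) *
          (ENNReal.ofReal (CP * (4 * r)) * G)) := by
        refine mul_le_mul_right (mul_le_mul' (hA x (4 * r) h4).2 hpoin) _
    _ = _ := by
        simp only [← mul_assoc]
        congr 1
        rw [← ENNReal.ofReal_mul (by positivity), ← ENNReal.ofReal_mul (by positivity),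
          ← ENNReal.ofReal_mul (by positivity), Real.mul_rpow (by norm_num) hr.le]
        congr 1
        field_simp

theorem iUnion_dyadic_annulus (x : X) {ε : ℝ} (hε : 0 < ε) :
    ⋃ k : ℕ, {y : X | ε * 2 ^ k < dist x y ∧ dist x y ≤ 2 * (ε * 2 ^ k)} =
      {y | ε < dist x y} := by
  ext y
  simp only [Set.mem_iUnion, Set.mem_ofPred_eq]
  constructor
  · rintro ⟨k, hk, -⟩
    exact lt_of_le_of_lt (le_mul_of_one_le_right hε.le (one_le_pow₀ one_le_two)) hk
  · intro h
    obtain ⟨n, hn₁, hn₂⟩ := exists_mem_Ioc_zpow (div_pos (hε.trans h) hε) (one_lt_two (α := ℝ))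
    rw [lt_div_iff₀ hε] at hn₁
    rw [div_le_iff₀ hε] at hn₂
    have hn : 0 ≤ n := by
      by_contra! hneg
      have : (2 : ℝ) ^ (n + 1) ≤ 1 := zpow_le_one_of_nonpos₀ one_le_two (by omega)
      nlinarith
    lift n to ℕ using hn
    refine ⟨n, by rw [mul_comm]; exact_mod_cast hn₁, hn₂.trans_eq ?_⟩
    norm_cast
    push_cast
    ring

theorem pairwise_disjoint_dyadic_annulus (x : X) {ε : ℝ} (hε : 0 < ε) :
    Pairwise (Function.onFun Disjoint fun k : ℕ =>
      {y : X | ε * 2 ^ k < dist x y ∧ dist x y ≤ 2 * (ε * 2 ^ k)}) := by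
  refine (pairwise_disjoint_on _).2 fun j k hjk => Set.disjoint_left.2 fun y hj hk => ?_
  have h1 : (2 : ℝ) ^ (j + 1) ≤ 2 ^ k := pow_le_pow_right₀ one_le_two hjk
  have h2 : ε * 2 ^ (j + 1) ≤ ε * 2 ^ k := by gcongr
  have h3 := hj.2
  have h4 := hk.1
  rw [pow_succ] at h2
  linarith

/-- Pointwise Hedberg-type estimate for the maximal singular operator. -/
theorem maxT_le_maximalFn_rpow_mul {μ : Measure X} {c₁ c₂ ν CK CP σ ρ' p q : ℝ} {K : X → X → ℝ}
    {f : X → ℝ} {g : X → ℝ≥0∞} (hc₁ : 0 < c₁) (hc₂ : 0 < c₂) (hA : IsAhlfors μ c₁ c₂ ν)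
    (hν : 0 < ν) (hK : Measurable (Function.uncurry K)) (hCK : 0 < CK)
    (hsize : SizeCond K CK ν) (hnull : NullCond μ K) (hρ' : 1 < ρ') (hCP : 0 < CP) (hσ : 1 ≤ σ)
    (hPS : PoincareSobolev μ f g ρ' CP σ) (hp : 1 < p) (hq : 0 < q) (hqν : q / ν < 1)
    (hg : morreyNorm μ p q g ≠ ∞) :
    ∃ C : ℝ≥0∞, C ≠ ∞ ∧ ∀ x, maxT μ K f x ≤
      C * (maximalFn μ g x ^ (1 - q / ν) * morreyNorm μ p q g ^ (q / ν)) := by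
  have hβ : 1 < ν / q := by
    rw [one_lt_div hq]
    rwa [div_lt_one hν] at hqν
  obtain ⟨C, hC, hsum⟩ := ENNReal.exists_tsum_dyadic_le hβ
  set N := morreyNorm μ p q g
  set D := ENNReal.ofReal (1 / c₁)
  have hD0 : D ≠ 0 := (ofReal_pos.2 (by positivity)).ne'
  have hDtop : D ≠ ∞ := ofReal_ne_top
  set Q := ENNReal.ofReal (CK * c₂ * 4 ^ ν * CP)
  have hqν0 : 0 < q / ν := by positivity
  refine ⟨Q * ENNReal.ofReal C * (D ^ (1 / q)) ^ (q / ν), by finiteness,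
    fun x => iSup₂_le fun ε hε => ?_⟩
  by_cases hint : IntegrableOn (fun y => K x y * f y) {y | ε < dist x y} μ
  swap
  · rw [truncT, integral_undef hint]
    simp
  set S : ℕ → Set X := fun k => {y : X | ε * 2 ^ k < dist x y ∧ dist x y ≤ 2 * (ε * 2 ^ k)}
  have hU : ⋃ k, S k = {y | ε < dist x y} := iUnion_dyadic_annulus x hε
  let a : ℕ → ℝ≥0∞ := fun k => (μ (ball x (σ * (4 * (ε * 2 ^ k)))))⁻¹ *
    ∫⁻ y in ball x (σ * (4 * (ε * 2 ^ k))), g y ∂μ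
  have hrad : ∀ k : ℕ, 0 < σ * (4 * (ε * 2 ^ k)) := fun k => by positivity
  have ha : ∀ k, a k ≤ maximalFn μ g x := fun k =>
    laverage_le_maximalFn μ g x (hrad k) (mem_ball_self (hrad k))
  have ha' : ∀ k, a k ≤ (D ^ (1 / q) * N) * ENNReal.ofReal (4 * ε * 2 ^ k) ^ (-(ν / q)) := by
    intro k
    set w := 4 * ε * 2 ^ k
    have hw : 0 < w := by positivity
    have hw' : 4 * (ε * 2 ^ k) = w := by ring
    have hm0 := (hA.measure_ball_pos hc₁ x (hrad k)).ne'
    have hm := (hA.measure_ball_lt_top x (σ * (4 * (ε * 2 ^ k)))).ne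
    have hlow : ENNReal.ofReal w ^ ν ≤ D * μ (ball x (σ * (4 * (ε * 2 ^ k)))) := by
      calc ENNReal.ofReal w ^ ν = ENNReal.ofReal (1 / c₁ * (c₁ * w ^ ν)) := by
            rw [ENNReal.ofReal_rpow_of_pos hw]
            congr 1
            field_simp
        _ ≤ D * ENNReal.ofReal (c₁ * (σ * w) ^ ν) := by
            rw [ENNReal.ofReal_mul (by positivity)]
            gcongr
            exact le_mul_of_one_le_left hw.le hσ
        _ ≤ _ := by
            gcongr
            rw [hw']
            exact (hA x (σ * w) (by positivity)).1
    calc a k ≤ μ (ball x (σ * (4 * (ε * 2 ^ k)))) ^ (-(1 / q)) * N :=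
          laverage_le_morreyNorm g hp x (hrad k) hm0 hm
      _ ≤ D ^ (1 / q) * (ENNReal.ofReal w ^ ν) ^ (-(1 / q)) * N := by
          gcongr
          exact ENNReal.rpow_neg_le_mul_rpow_neg hD0 hDtop (by positivity) hlow
      _ = _ := by
          rw [← ENNReal.rpow_mul, show ν * -(1 / q) = -(ν / q) by ring]
          ring
  calc ENNReal.ofReal |truncT μ K f ε x| = ‖∑' k, ∫ y in S k, K x y * f y ∂μ‖ₑ := by
        rw [← Real.norm_eq_abs, ofReal_norm, truncT, ← hU, integral_iUnion
          (fun k => measurableSet_annulus x _ _) (pairwise_disjoint_dyadic_annulus x hε)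
          (hU ▸ hint)]
    _ ≤ ∑' k, ‖∫ y in S k, K x y * f y ∂μ‖ₑ := enorm_tsum_le_tsum_enorm
    _ ≤ ∑' k, Q * (ENNReal.ofReal (4 * (ε * 2 ^ k)) * a k) := by
        gcongr with k
        refine enorm_setIntegral_annulus_le hc₁ hc₂ hA hν hK hCK hsize hnull hρ' hCP hPS x
          (by positivity) (hint.mono_set ?_)
        rw [← hU]
        exact Set.subset_iUnion S k
    _ = Q * ∑' k, ENNReal.ofReal (4 * ε * 2 ^ k) * a k := by
        rw [ENNReal.tsum_mul_left]
        simp only [mul_assoc]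
    _ ≤ Q * (ENNReal.ofReal C * (maximalFn μ g x ^ (1 - 1 / (ν / q)) *
          (D ^ (1 / q) * N) ^ (1 / (ν / q)))) :=
        mul_le_mul_right (hsum (4 * ε) _ _ a (by positivity) (by finiteness) ha ha') _
    _ = _ := by
        rw [one_div_div, mul_rpow_of_nonneg _ _ hqν0.le]
        ring

/-- Morrey-space functional inequality:
`‖T^*_K f‖_{M^{p₁,q₁}} ≤ C ‖g‖_{M^{(1-q/ν)p₁,(1-q/ν)q₁}}^{1-q/ν} ‖g‖_{M^{p,q}}^{q/ν}`. -/
theorem morrey_functional_inequality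
    (μ : Measure X) (c₁ c₂ ν CK CP σ ρ' : ℝ) (K : X → X → ℝ) (f : X → ℝ) (g : X → ℝ≥0∞)
    (hc₁ : 0 < c₁) (hc₁₂ : c₁ ≤ c₂) (hν : 0 < ν) (hA : IsAhlfors μ c₁ c₂ ν)
    (hbal : (2 : ℝ) ^ (1 - ν) * (c₂ / c₁) < 1)
    (hK : Measurable (Function.uncurry K)) (hCK : 0 < CK)
    (hsize : SizeCond K CK ν) (hnull : NullCond μ K)
    (hf : LocallyIntegrable f μ) (hg : LocIntE μ g)
    (hρ'1 : 1 < ρ') (hρ'ν : ρ' < ν) (hCP : 0 < CP) (hσ : 1 ≤ σ)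
    (hPS : PoincareSobolev μ f g ρ' CP σ)
    (p q p₁ q₁ : ℝ) (hp : 1 < p) (hpq : p ≤ q) (hqν : q / ν < 1)
    (hgM : morreyNorm μ p q g < ∞)
    (hp₁ : 1 < p₁) (hp₁q₁ : p₁ ≤ q₁) (hp₁' : 1 < (1 - q / ν) * p₁)
    (hgM' : morreyNorm μ ((1 - q / ν) * p₁) ((1 - q / ν) * q₁) g < ∞) :
    ∃ C : ℝ, 0 < C ∧
      morreyNorm μ p₁ q₁ (maxT μ K f) ≤
        ENNReal.ofReal C *
          morreyNorm μ ((1 - q / ν) * p₁) ((1 - q / ν) * q₁) g ^ (1 - q / ν) *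
          morreyNorm μ p q g ^ (q / ν) := by
  have hc₂ : 0 < c₂ := hc₁.trans_le hc₁₂
  have hq : 0 < q := by linarith
  have hp₁0 : 0 < p₁ := by linarith
  have hθ : 0 < 1 - q / ν := by linarith
  have hst : (1 - q / ν) * p₁ ≤ (1 - q / ν) * q₁ := by gcongr
  have hratio : (1 - q / ν) * p₁ / ((1 - q / ν) * q₁) = p₁ / q₁ :=
    mul_div_mul_left _ _ hθ.ne'
  obtain ⟨C, hC, hpt⟩ := maxT_le_maximalFn_rpow_mul hc₁ hc₂ hA hν hK hCK hsize hnull hρ'1 hCP hσ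
    hPS hp hq hqν hgM.ne
  obtain ⟨C', hC', hmax⟩ := mul_lintegral_maximalFn_rpow_le hA hc₁ hc₂ hν hp₁' hst
  rw [hratio] at hmax
  set θ := 1 - q / ν
  set N := morreyNorm μ p q g
  set N' := morreyNorm μ (θ * p₁) (θ * q₁) g
  have hq0 : 0 ≤ q / ν := by positivity
  have hconst : (C * N ^ (q / ν)) ^ p₁ ≠ ∞ := by finiteness
  have hCC' : C * C' ^ (1 / p₁) ≠ ∞ := by finiteness
  refine ⟨(C * C' ^ (1 / p₁)).toReal + 1, by positivity,
    iSup_le fun z => iSup₂_le fun r hr => ?_⟩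
  have hlint : ∫⁻ x in ball z r, maxT μ K f x ^ p₁ ∂μ ≤
      (C * N ^ (q / ν)) ^ p₁ * ∫⁻ x in ball z r, maximalFn μ g x ^ (θ * p₁) ∂μ := by
    rw [← lintegral_const_mul' _ _ hconst]
    refine lintegral_mono fun x => ?_
    calc maxT μ K f x ^ p₁ ≤ (C * (maximalFn μ g x ^ θ * N ^ (q / ν))) ^ p₁ := by
          gcongr
          exact hpt x
      _ = _ := by
          rw [ENNReal.rpow_mul, ← mul_rpow_of_nonneg _ _ hp₁0.le]
          ring_nf
  calc (μ (ball z r) ^ (p₁ / q₁ - 1) * ∫⁻ x in ball z r, maxT μ K f x ^ p₁ ∂μ) ^ (1 / p₁)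
      ≤ ((C * N ^ (q / ν)) ^ p₁ * (C' * N' ^ (θ * p₁))) ^ (1 / p₁) := by
        refine rpow_le_rpow ((mul_le_mul_right hlint _).trans ?_) (by positivity)
        rw [mul_left_comm]
        exact mul_le_mul_right (hmax g hg.1 z r hr) _
    _ = C * C' ^ (1 / p₁) * N' ^ θ * N ^ (q / ν) := by
        rw [mul_rpow_of_nonneg _ _ (one_div_nonneg.2 hp₁0.le),
          mul_rpow_of_nonneg C' _ (one_div_nonneg.2 hp₁0.le), ← ENNReal.rpow_mul, ← ENNReal.rpow_mul, mul_one_div_cancel hp₁0.ne', mul_assoc θ,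
          mul_one_div_cancel hp₁0.ne', mul_one, ENNReal.rpow_one]
        ring
    _ ≤ _ := by
        gcongr
        refine (ofReal_toReal hCC').symm.le.trans (ENNReal.ofReal_le_ofReal ?_)
        linarith
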